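/- arXiv:2412.20753 — 4 statements merged into one kernel-verified Lean document; each statement's English description precedes it below -/
import Mathlib

section
/- Let m be a positive odd integer, and let a = (0,…,0) and b = (1,…,1) in ℤ_2^d. Then a and b are strongly cospectral relative to H_m: for every eigenvalue λ of H_m there is μ_λ ∈ {1, −1} with E_λ e_a = μ_λ E_λ e_b, where E_λ is the orthogonal projection onto ker(H_m − λI). Moreover the eigenvalue support Λ_a = {λ : E_λ e_a ≠ 0} is symmetric about zero: λ ∈ Λ_a if and only if −λ ∈ Λ_a. -/
open Matrix

/-- The real symmetric matrix `H_m` indexed by `ℤ_2^d`: entry `m` when `u - v = e_0`,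
entry `2` when `u - v = e_j` for some `j ≠ 0`, and `0` otherwise. -/
noncomputable def Hm (d m : ℕ) [NeZero d] :
    Matrix (Fin d → ZMod 2) (Fin d → ZMod 2) ℝ :=
  Matrix.of fun u v =>
    if u - v = Pi.single (0 : Fin d) 1 then (m : ℝ)
    else if ∃ j : Fin d, j ≠ 0 ∧ u - v = Pi.single j 1 then 2 else 0

/-- The Hamming weight of `g ∈ ℤ_2^d`. -/
def wt {d : ℕ} (g : Fin d → ZMod 2) : ℕ := (Finset.univ.filter fun j => g j ≠ 0).card

/-- The character vector `ψ_g(x) = (-1)^{⟨g,x⟩}` of `ℤ_2^d`. -/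
def psi {d : ℕ} (g : Fin d → ZMod 2) : (Fin d → ZMod 2) → ℝ :=
  fun x => (-1 : ℝ) ^ (∑ j, (g j).val * (x j).val)

/-- `E` is the orthogonal projection onto `ker(M - μ I)`: `E` is symmetric, idempotent,
its range is contained in the eigenspace, and it fixes the eigenspace. -/
def IsEigenprojR {n : Type*} [Fintype n] (M : Matrix n n ℝ) (μ : ℝ) (E : Matrix n n ℝ) :
    Prop :=
  E.IsHermitian ∧ E * E = E ∧ M * E = μ • E ∧ ∀ v : n → ℝ, M *ᵥ v = μ • v → E *ᵥ v = v

/-- weights of the flips -/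
def wgt (d m : ℕ) [NeZero d] (j : Fin d) : ℕ := if j = 0 then m else 2

lemma Hm_mulVec (d m : ℕ) [NeZero d] (v : (Fin d → ZMod 2) → ℝ) (u : Fin d → ZMod 2) :
    (Hm d m *ᵥ v) u = ∑ j, (wgt d m j : ℝ) * v (u + Pi.single j 1) := by
  have h : ∀ x, Hm d m u x
      = ∑ j, (wgt d m j : ℝ) * (if x = u + Pi.single j 1 then 1 else 0) := by
    intro x
    have key : ∀ j : Fin d, (x = u + Pi.single j 1) ↔ u - x = Pi.single j 1 := by
      intro j
      have h2 : (Pi.single j 1 : Fin d → ZMod 2) = - Pi.single j 1 := by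
        funext k; exact (ZMod.neg_eq_self_mod_two _).symm
      constructor
      · intro hx
        rw [hx, sub_add_cancel_left]; exact h2.symm
      · intro hx
        rw [h2, ← hx]; abel
    have inj : ∀ i j : Fin d, u - x = Pi.single i 1 → u - x = Pi.single j 1 → i = j := by
      intro i j hi hj
      rw [hi] at hj
      by_contra hne
      have := congrFun hj i
      simp [Pi.single_apply, hne] at this
    simp only [key, Hm, Matrix.of_apply]
    by_cases hex : ∃ j : Fin d, u - x = Pi.single j 1
    · obtain ⟨j, hj⟩ := hex
      rw [Finset.sum_eq_single j]
      · by_cases h0 : j = 0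
        · subst h0; simp [hj, wgt]
        · have n0 : ¬ u - x = Pi.single (0 : Fin d) 1 := fun h => h0 (inj _ _ hj h)
          rw [if_neg n0, if_pos ⟨j, h0, hj⟩, if_pos hj]; simp [wgt, h0]
      · intro k _ hk
        rw [if_neg (fun h => hk (inj _ _ h hj))]; simp
      · simp
    · push Not at hex
      rw [if_neg (hex 0), if_neg (by rintro ⟨j, _, hj⟩; exact hex j hj)]
      simp [hex]
  simp only [Matrix.mulVec, dotProduct, h, Finset.sum_mul]
  rw [Finset.sum_comm]
  refine Finset.sum_congr rfl fun j _ => ?_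
  simp

lemma psi_prod {d : ℕ} (g x : Fin d → ZMod 2) :
    psi g x = ∏ j, (-1 : ℝ) ^ ((g j).val * (x j).val) := by
  simp [psi, Finset.prod_pow_eq_pow_sum]

lemma psi_add {d : ℕ} (g x y : Fin d → ZMod 2) : psi g (x + y) = psi g x * psi g y := by
  simp only [psi_prod, ← Finset.prod_mul_distrib]
  refine Finset.prod_congr rfl fun j _ => ?_
  simp only [Pi.add_apply]
  generalize g j = a
  generalize x j = b
  generalize y j = c
  have h2 : ∀ t : ZMod 2, t = 0 ∨ t = 1 := by decide
  have h11 : (1 + 1 : ZMod 2) = 0 := by decide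
  obtain rfl | rfl := h2 a <;> obtain rfl | rfl := h2 b <;> obtain rfl | rfl := h2 c <;>
    simp [ZMod.val_one, h11]

lemma psi_single {d : ℕ} (g : Fin d → ZMod 2) (j : Fin d) :
    psi g (Pi.single j 1) = (-1 : ℝ) ^ (g j).val := by
  unfold psi
  rw [Finset.sum_eq_single j]
  · simp [ZMod.val_one]
  · intro k _ hk; simp [hk]
  · simp

lemma psi_one {d : ℕ} (g : Fin d → ZMod 2) :
    psi g 1 = (-1 : ℝ) ^ (∑ j, (g j).val) := by
  simp [psi, ZMod.val_one]

lemma sum_psi {d : ℕ} (x : Fin d → ZMod 2) :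
    ∑ g, psi g x = if x = 0 then (2 : ℝ) ^ d else 0 := by
  simp only [psi_prod]
  have := (Finset.prod_univ_sum (fun _ : Fin d => (Finset.univ : Finset (ZMod 2)))
    (fun j t => (-1 : ℝ) ^ (t.val * (x j).val)))
  rw [Fintype.piFinset_univ] at this
  rw [← this]
  have h1 : ∀ b : ZMod 2, ∑ t : ZMod 2, (-1 : ℝ) ^ (t.val * b.val) = if b = 0 then 2 else 0 := by
    intro b
    have : ∑ t : ZMod 2, (-1 : ℝ) ^ (t.val * b.val)
        = (-1 : ℝ) ^ ((0 : ZMod 2).val * b.val) + (-1 : ℝ) ^ ((1 : ZMod 2).val * b.val) :=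
      Fin.sum_univ_two _
    rw [this]
    obtain rfl | rfl : b = 0 ∨ b = 1 := (by decide : ∀ t : ZMod 2, t = 0 ∨ t = 1) b
    · norm_num
    · norm_num [ZMod.val_one]
  simp only [h1]
  split_ifs with hx
  · subst hx; simp
  · obtain ⟨j, hj⟩ := Function.ne_iff.mp hx
    exact Finset.prod_eq_zero (Finset.mem_univ j) (if_neg hj)

/-- Fourier coefficient -/
noncomputable def fc {d : ℕ} (v : (Fin d → ZMod 2) → ℝ) (g : Fin d → ZMod 2) : ℝ :=
  ∑ x, v x * psi g x

lemma fc_inv {d : ℕ} (v : (Fin d → ZMod 2) → ℝ) (y : Fin d → ZMod 2) :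
    ∑ g, psi g y * fc v g = 2 ^ d * v y := by
  have h : ∀ g, psi g y * fc v g = ∑ x, v x * psi g (x + y) := by
    intro g
    rw [fc, Finset.mul_sum]
    refine Finset.sum_congr rfl fun x _ => ?_
    rw [psi_add]; ring
  have h2 : ∀ x : Fin d → ZMod 2, x + y = 0 ↔ x = y := by
    intro x
    have hy : -y = y := by funext k; exact ZMod.neg_eq_self_mod_two _
    rw [add_eq_zero_iff_eq_neg, hy]
  simp only [h]
  rw [Finset.sum_comm]
  simp only [← Finset.mul_sum, sum_psi, h2]
  simp [mul_comm]

/-- The eigenvalue of `psi g`. -/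
noncomputable def ev (d m : ℕ) [NeZero d] (g : Fin d → ZMod 2) : ℝ :=
  ∑ j, (wgt d m j : ℝ) * (-1 : ℝ) ^ (g j).val

lemma fc_H (d m : ℕ) [NeZero d] (v : (Fin d → ZMod 2) → ℝ) (g : Fin d → ZMod 2) :
    fc (Hm d m *ᵥ v) g = ev d m g * fc v g := by
  unfold fc ev
  simp only [Hm_mulVec, Finset.sum_mul]
  rw [Finset.sum_comm]
  refine Finset.sum_congr rfl fun j _ => ?_
  rw [Finset.mul_sum, ← Equiv.sum_comp (Equiv.addRight (Pi.single j 1 : Fin d → ZMod 2))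
    (fun x => (wgt d m j : ℝ) * (-1 : ℝ) ^ (g j).val * (v x * psi g x))]
  refine Finset.sum_congr rfl fun x _ => ?_
  simp only [Equiv.coe_addRight]
  rw [psi_add, psi_single]
  have : ((-1 : ℝ) ^ (g j).val) * ((-1 : ℝ) ^ (g j).val) = 1 := by
    rw [← mul_pow]; norm_num
  linear_combination (-(wgt d m j : ℝ) * v (x + Pi.single j 1) * psi g x) * this

lemma ev_inj (d m : ℕ) [NeZero d] (hmodd : Odd m) (g h : Fin d → ZMod 2)
    (e : ev d m g = ev d m h) : psi g 1 = psi h 1 := by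
  have hs : ∀ a : ZMod 2, (-1 : ℝ) ^ a.val = 1 - 2 * (a.val : ℝ) := by
    intro a
    obtain rfl | rfl : a = 0 ∨ a = 1 := by revert a; decide
    · norm_num
    · norm_num [ZMod.val_one]
  have e1 : ∑ j, wgt d m j * (g j).val = ∑ j, wgt d m j * (h j).val := by
    have : ∀ g : Fin d → ZMod 2, ev d m g = (∑ j, (wgt d m j : ℝ))
        - 2 * ((∑ j, wgt d m j * (g j).val : ℕ) : ℝ) := by
      intro g
      unfold ev
      push_cast
      rw [Finset.mul_sum, ← Finset.sum_sub_distrib]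
      refine Finset.sum_congr rfl fun j _ => ?_
      rw [hs]; ring
    rw [this, this] at e
    have e' : ((∑ j, wgt d m j * (g j).val : ℕ) : ℝ)
      = ((∑ j, wgt d m j * (h j).val : ℕ) : ℝ) := by linarith
    exact_mod_cast e'
  have sp : ∀ g : Fin d → ZMod 2, ∑ j, wgt d m j * (g j).val
      = m * (g 0).val + 2 * ∑ j ∈ Finset.univ.erase 0, (g j).val := by
    intro g
    rw [← Finset.add_sum_erase _ _ (Finset.mem_univ (0 : Fin d)), Finset.mul_sum]
    congr 1
    refine Finset.sum_congr rfl fun j hj => ?_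
    simp [wgt, Finset.ne_of_mem_erase hj]
  rw [sp, sp] at e1
  rw [psi_one, psi_one, ← Finset.add_sum_erase _ _ (Finset.mem_univ (0 : Fin d)),
    ← Finset.add_sum_erase _ (fun j => (h j).val) (Finset.mem_univ (0 : Fin d))]
  have hg := ZMod.val_lt (g 0)
  have hh := ZMod.val_lt (h 0)
  obtain ⟨k, hk⟩ := hmodd
  congr 1
  generalize (g 0).val = a at *
  generalize (h 0).val = b at *
  interval_cases a <;> interval_cases b <;> omega

lemma eig_sign (d m : ℕ) [NeZero d] (hmodd : Odd m) (lam : ℝ) :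
    ∃ μ : ℝ, (μ = 1 ∨ μ = -1) ∧ ∀ v : (Fin d → ZMod 2) → ℝ, Hm d m *ᵥ v = lam • v →
      v 0 = μ * v 1 := by
  have hμ : ∃ μ : ℝ, (μ = 1 ∨ μ = -1) ∧ ∀ g, ev d m g = lam → psi g 1 = μ := by
    by_cases hex : ∃ g, ev d m g = lam
    · obtain ⟨g, hg⟩ := hex
      refine ⟨psi g 1, ?_, fun h hh => ev_inj d m hmodd _ _ (hh.trans hg.symm)⟩
      rw [psi_one]
      exact neg_one_pow_eq_or ℝ _
    · exact ⟨1, Or.inl rfl, fun g hg => absurd ⟨g, hg⟩ hex⟩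
  obtain ⟨μ, h1, h2⟩ := hμ
  refine ⟨μ, h1, fun v hv => ?_⟩
  have hmm : μ * μ = 1 := by rcases h1 with rfl | rfl <;> norm_num
  have i0 := fc_inv v 0
  have i1 := fc_inv v 1
  have hp : ∀ g : Fin d → ZMod 2, psi g 0 = 1 := by intro g; simp [psi]
  have : ∑ g, psi g 0 * fc v g = μ * ∑ g, psi g 1 * fc v g := by
    rw [Finset.mul_sum]
    refine Finset.sum_congr rfl fun g _ => ?_
    by_cases hg : ev d m g = lam
    · rw [h2 g hg, hp, ← mul_assoc, hmm]
    · have hf := fc_H d m v g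
      rw [hv] at hf
      have : fc (lam • v) g = lam * fc v g := by
        simp [fc, Finset.mul_sum, mul_assoc]
      rw [this] at hf
      have hz : fc v g = 0 := by
        have : (ev d m g - lam) * fc v g = 0 := by linarith
        exact (mul_eq_zero.mp this).resolve_left (sub_ne_zero.mpr hg)
      simp [hz]
  rw [i0, i1] at this
  have h2d : (2 : ℝ) ^ d ≠ 0 := by positivity
  apply mul_left_cancel₀ h2d
  linarith

lemma supp_neg (d m : ℕ) [NeZero d]
    (E : ℝ → Matrix (Fin d → ZMod 2) (Fin d → ZMod 2) ℝ)
    (hE : ∀ lam : ℝ, IsEigenprojR (Hm d m) lam (E lam)) (lam : ℝ)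
    (h : E lam *ᵥ Pi.single (0 : Fin d → ZMod 2) 1 ≠ 0) :
    E (-lam) *ᵥ Pi.single (0 : Fin d → ZMod 2) 1 ≠ 0 := by
  obtain ⟨hs, hi, hM, -⟩ := hE lam
  obtain ⟨hs', -, -, hf⟩ := hE (-lam)
  have sy : ∀ u x, E lam u x = E lam x u := fun u x => by simpa using hs.apply x u
  have sy' : ∀ u x, E (-lam) u x = E (-lam) x u := fun u x => by simpa using hs'.apply x u
  have hpos : E lam 0 0 ≠ 0 := by
    intro h0
    apply h
    have h1 := congrFun (congrFun hi 0) 0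
    rw [h0, Matrix.mul_apply] at h1
    funext u
    have h2 := (Finset.sum_eq_zero_iff_of_nonneg (fun x _ => by
      rw [sy x 0]; exact mul_self_nonneg _)).mp h1 u (Finset.mem_univ u)
    rw [sy 0 u] at h2
    simpa using h2
  set v : (Fin d → ZMod 2) → ℝ := fun x => psi 1 x * E lam x 0 with hv
  have hHv : Hm d m *ᵥ v = (-lam) • v := by
    funext u
    have h1 : (Hm d m *ᵥ (fun x => E lam x 0)) u = lam * E lam u 0 := by
      have := congrFun (congrFun hM u) 0
      simpa [Matrix.mul_apply, Matrix.mulVec, dotProduct] using this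
    rw [Hm_mulVec] at h1 ⊢
    simp only [hv, psi_add, psi_single, Pi.smul_apply, smul_eq_mul]
    rw [show -lam * (psi 1 u * E lam u 0) = - psi 1 u * (lam * E lam u 0) by ring, ← h1,
      Finset.mul_sum]
    refine Finset.sum_congr rfl fun j _ => ?_
    simp [ZMod.val_one]
    ring
  have h3 := congrFun (hf v hHv) 0
  intro h0
  have hz : ∀ x, E (-lam) 0 x = 0 := by
    intro x
    rw [sy']
    simpa using congrFun h0 x
  simp [Matrix.mulVec, dotProduct, hz, hv, psi] at h3
  exact hpos h3.symm

/-- for `m` a positive odd integer, the vertices `a = (0,…,0)` and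
`b = (1,…,1)` are strongly cospectral relative to `H_m` (with `μ_λ ∈ {1, -1}`), and the
eigenvalue support of `a` is symmetric about zero. -/
theorem stmt7 (d m : ℕ) [NeZero d] (hm : 0 < m) (hmodd : Odd m)
    (E : ℝ → Matrix (Fin d → ZMod 2) (Fin d → ZMod 2) ℝ)
    (hE : ∀ lam : ℝ, IsEigenprojR (Hm d m) lam (E lam)) :
    (∀ lam : ℝ, (∃ v : (Fin d → ZMod 2) → ℝ, v ≠ 0 ∧ Hm d m *ᵥ v = lam • v) →
      ∃ μ : ℝ, (μ = 1 ∨ μ = -1) ∧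
        E lam *ᵥ Pi.single (0 : Fin d → ZMod 2) 1
          = μ • (E lam *ᵥ Pi.single (1 : Fin d → ZMod 2) 1))
    ∧ ∀ lam : ℝ, E lam *ᵥ Pi.single (0 : Fin d → ZMod 2) 1 ≠ 0
        ↔ E (-lam) *ᵥ Pi.single (0 : Fin d → ZMod 2) 1 ≠ 0 := by
  refine ⟨fun lam _ => ?_, fun lam => ⟨supp_neg d m E hE lam, fun h => ?_⟩⟩
  · obtain ⟨μ, h1, h2⟩ := eig_sign d m hmodd lam
    refine ⟨μ, h1, ?_⟩
    obtain ⟨hs, -, hM, -⟩ := hE lam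
    have sy : ∀ u x, E lam u x = E lam x u := fun u x => by simpa using hs.apply x u
    funext u
    have := h2 (fun x => E lam x u) (by
      funext y
      have := congrFun (congrFun hM y) u
      simpa [Matrix.mul_apply, Matrix.mulVec, dotProduct] using this)
    simpa [sy u] using this
  · simpa using supp_neg d m E hE (-lam) h
end

section
/- Let q, λ_1, …, λ_k be positive integers such that (i) λ_r ∈ (0, q/2) ∪ (q/2, q) for each r, and (ii) the square-free parts of q² − λ_1², …, q² − λ_k² are pairwise distinct (equivalently, for all r ≠ s, (q² − λ_r²)(q² − λ_s²) is not a perfect square). Then the real numbers π, arccos(λ_1/q), arccos(λ_2/q), …, arccos(λ_k/q) are linearly independent over ℚ: if ℓ_0, ℓ_1, …, ℓ_k are integers with ℓ_0·π + Σ_{r=1}^k ℓ_r·arccos(λ_r/q) = 0, then ℓ_0 = ℓ_1 = … = ℓ_k = 0. -/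
lemma aux_relation {K : Type*} [Field K] [Algebra ℚ K] [IsGalois ℚ K] {ι : Type*} [DecidableEq ι]
    (z y : ι → K) (a b : ι → ℚ)
    (hz : ∀ t, z t = algebraMap ℚ K (a t) + y t)
    (hy : ∀ t, y t ^ 2 = algebraMap ℚ K (b t))
    (hz1 : ∀ t, z t * (algebraMap ℚ K (a t) - y t) = 1)
    (hyy : ∀ r s, r ≠ s → ∀ c : ℚ, y r * y s ≠ algebraMap ℚ K c)
    (s : ι) (S : Finset ι) :
    ∀ (m : ι → ℤ) (n : ℤ), s ∉ S → n ≠ 0 → (∏ t ∈ S, z t ^ m t) * z s ^ n = 1 →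
      ∃ N : ℤ, N ≠ 0 ∧ z s ^ N = 1 := by
  have hz0 : ∀ t, z t ≠ 0 := fun t h0 => by
    have := hz1 t
    rw [h0] at this; simp at this
  have hinv : ∀ t, algebraMap ℚ K (a t) - y t = (z t)⁻¹ := fun t =>
    eq_inv_of_mul_eq_one_right (hz1 t)
  -- action of automorphisms
  have hσy : ∀ (σ : K ≃ₐ[ℚ] K) t, σ (y t) = y t ∨ σ (y t) = - y t := by
    intro σ t
    have : (σ (y t)) ^ 2 = y t ^ 2 := by rw [← map_pow, hy, AlgEquiv.commutes]
    exact sq_eq_sq_iff_eq_or_eq_neg.mp this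
  have hfix : ∀ (σ : K ≃ₐ[ℚ] K) t, σ (y t) = y t → σ (z t) = z t := by
    intro σ t h
    rw [hz, map_add, h, AlgEquiv.commutes]
  have hflip : ∀ (σ : K ≃ₐ[ℚ] K) t, σ (y t) = - y t → σ (z t) = (z t)⁻¹ := by
    intro σ t h
    rw [← hinv, hz, map_add, h, AlgEquiv.commutes, sub_eq_add_neg]
  have hchi : ∀ (σ : K ≃ₐ[ℚ] K), ∃ e : ι → ℤ, ∀ t, σ (z t) = z t ^ e t := by
    intro σ
    have : ∀ t, ∃ e : ℤ, σ (z t) = z t ^ e := by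
      intro t
      rcases hσy σ t with h | h
      · exact ⟨1, by rw [hfix σ t h, zpow_one]⟩
      · exact ⟨-1, by rw [hflip σ t h, zpow_neg_one]⟩
    choose e he using this
    exact ⟨e, he⟩
  induction S using Finset.induction_on with
  | empty =>
    intro m n _ hn h
    exact ⟨n, hn, by simpa using h⟩
  | insert r S hr ih =>
    intro m n hs hn h
    simp only [Finset.mem_insert, not_or] at hs
    obtain ⟨hsr, hsS⟩ := hs
    obtain ⟨σ, hσ⟩ : ∃ σ : K ≃ₐ[ℚ] K, σ (y r * y s) ≠ y r * y s := by
      by_contra hcon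
      push Not at hcon
      obtain ⟨c, hc⟩ := (InfiniteGalois.mem_range_algebraMap_iff_fixed (k := ℚ) (y r * y s)).mpr hcon
      exact hyy r s (Ne.symm hsr) c hc.symm
    obtain ⟨e, he⟩ := hchi σ
    rw [Finset.prod_insert hr] at h
    have h2 := congrArg σ h
    rw [map_mul, map_mul, map_prod, map_one] at h2
    simp only [map_zpow₀] at h2
    rcases hσy σ r with hyr | hyr <;> rcases hσy σ s with hys | hys
    · exact absurd (by rw [map_mul, hyr, hys]) hσ
    · -- s flipped, r fixed: divide
      rw [hfix σ r hyr, hflip σ s hys] at h2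
      refine ih (fun t => m t - e t * m t) (2 * n) hsS (by omega) ?_
      have h3 := congrArg₂ (· / ·) h h2
      simp only [he, ← zpow_mul] at h3
      rw [div_one] at h3
      rw [← h3]
      simp only [zpow_sub₀ (hz0 _), Finset.prod_div_distrib]
      have h4 : z s ^ (2 * n) = z s ^ n / (z s)⁻¹ ^ n := by
        rw [inv_zpow, div_inv_eq_mul, two_mul, zpow_add₀ (hz0 s)]
      rw [h4]
      have := zpow_ne_zero (m r) (hz0 r)
      field_simp
    · rw [hflip σ r hyr, hfix σ s hys] at h2
      refine ih (fun t => m t + e t * m t) (2 * n) hsS (by omega) ?_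
      have h3 := congrArg₂ (· * ·) h h2
      simp only [he, ← zpow_mul] at h3
      rw [mul_one] at h3
      rw [← h3]
      simp only [zpow_add₀ (hz0 _), Finset.prod_mul_distrib, two_mul, inv_zpow]
      have := zpow_ne_zero (m r) (hz0 r)
      field_simp
    · exact absurd (by rw [map_mul, hyr, hys, neg_mul_neg]) hσ


/-- if `q, λ_1, …, λ_k` are positive integers with each
`λ_r ∈ (0, q/2) ∪ (q/2, q)` and the square-free parts of the `q² - λ_r²` pairwise distinct
(equivalently, `(q² - λ_r²)(q² - λ_s²)` is never a perfect square for `r ≠ s`), then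
`π, arccos(λ_1/q), …, arccos(λ_k/q)` are linearly independent over `ℚ`. -/
theorem stmt11 (q : ℕ) (hq : 0 < q) (k : ℕ) (lam : Fin k → ℕ)
    (hpos : ∀ r, 0 < lam r)
    (hrange : ∀ r, ((lam r : ℝ) < (q : ℝ) / 2 ∨ (q : ℝ) / 2 < (lam r : ℝ))
      ∧ (lam r : ℝ) < (q : ℝ))
    (hsqf : ∀ r s, r ≠ s → ¬ IsSquare ((q ^ 2 - lam r ^ 2) * (q ^ 2 - lam s ^ 2)))
    (ℓ₀ : ℤ) (ℓ : Fin k → ℤ)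
    (h : (ℓ₀ : ℝ) * Real.pi + ∑ r, (ℓ r : ℝ) * Real.arccos ((lam r : ℝ) / q) = 0) :
    ℓ₀ = 0 ∧ ∀ r, ℓ r = 0 := by
  classical
  have hq' : (0 : ℝ) < q := by exact_mod_cast hq
  set θ : Fin k → ℝ := fun r => Real.arccos ((lam r : ℝ) / q) with hθ
  have hcos : ∀ r, Real.cos (θ r) = (lam r : ℝ) / q := by
    intro r
    refine Real.cos_arccos ?_ ?_
    · have : (0 : ℝ) ≤ (lam r : ℝ) / q := by positivity
      linarith
    · rw [div_le_one hq']
      exact (hrange r).2.le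
  have hsin : ∀ r, Real.sin (θ r) ^ 2 = 1 - ((lam r : ℝ) / q) ^ 2 := by
    intro r
    rw [Real.sin_sq, hcos]
  have hyC : ∀ r, ((Real.sin (θ r) : ℂ) * Complex.I) ^ 2
      = algebraMap ℚ ℂ (((lam r : ℚ) / q) ^ 2 - 1) := by
    intro r
    rw [mul_pow, Complex.I_sq, ← Complex.ofReal_pow, hsin]
    simp
  have hzC : ∀ r, Complex.exp (θ r * Complex.I)
      = algebraMap ℚ ℂ ((lam r : ℚ) / q) + (Real.sin (θ r) : ℂ) * Complex.I := by
    intro r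
    rw [Complex.exp_mul_I, ← Complex.ofReal_cos, ← Complex.ofReal_sin, hcos]
    simp
  have hmem : ∀ r, (Real.sin (θ r) : ℂ) * Complex.I ∈ algebraicClosure ℚ ℂ := by
    intro r
    rw [mem_algebraicClosure_iff']
    refine IsIntegral.of_pow (n := 2) (by norm_num) ?_
    rw [hyC]
    exact isIntegral_algebraMap
  have hcl : IsAlgClosure ℚ (algebraicClosure ℚ ℂ) := algebraicClosure.isAlgClosure ℚ ℂ
  have hgal : IsGalois ℚ (algebraicClosure ℚ ℂ) := IsAlgClosure.isGalois ℚ _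
  let y : Fin k → algebraicClosure ℚ ℂ := fun r => ⟨_, hmem r⟩
  let z : Fin k → algebraicClosure ℚ ℂ := fun r => algebraMap ℚ _ ((lam r : ℚ) / q) + y r
  have hzcoe : ∀ r, (z r : ℂ) = Complex.exp (θ r * Complex.I) := by
    intro r
    rw [hzC]
    rfl
  have hycoe : ∀ r, (y r : ℂ) = (Real.sin (θ r) : ℂ) * Complex.I := fun r => rfl
  have hy : ∀ r, y r ^ 2 = algebraMap ℚ (algebraicClosure ℚ ℂ) (((lam r : ℚ) / q) ^ 2 - 1) := by
    intro r
    apply Subtype.ext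
    exact hyC r
  have key : ∀ s, ℓ s = 0 := by
    intro s
    by_contra hs
    obtain ⟨N, hN, hzN⟩ := aux_relation z y (fun r => (lam r : ℚ) / q)
      (fun r => ((lam r : ℚ) / q) ^ 2 - 1) (fun _ => rfl) hy
      (by
        intro t
        have h1 := hy t
        rw [map_sub, map_pow, map_one] at h1
        simp only [z]
        linear_combination -h1)
      (by
        intro r t hrt c hc
        have h1 := congrArg (fun x : algebraicClosure ℚ ℂ => (x : ℂ)) hc
        have h2 : (Real.sin (θ r) : ℂ) * Complex.I * ((Real.sin (θ t) : ℂ) * Complex.I)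
            = algebraMap ℚ ℂ c := h1
        have h3 : (((-(Real.sin (θ r) * Real.sin (θ t)) : ℝ)) : ℂ) = ((c : ℝ) : ℂ) := by
          push_cast
          rw [eq_ratCast] at h2
          push_cast at h2
          rw [← h2]
          linear_combination (-Complex.sin (θ r) * Complex.sin (θ t)) * Complex.I_sq
        have h4 := Complex.ofReal_injective h3
        have h5 : (c : ℝ) ^ 2 = (1 - ((lam r : ℝ) / q) ^ 2) * (1 - ((lam t : ℝ) / q) ^ 2) := by
          rw [← h4, ← hsin, ← hsin]; ring
        apply hsqf r t hrt
        have hle : ∀ u, lam u ^ 2 ≤ q ^ 2 := fun u => by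
          have : lam u < q := by exact_mod_cast (hrange u).2
          exact Nat.pow_le_pow_left this.le 2
        rw [← Rat.isSquare_natCast_iff]
        refine ⟨c * q ^ 2, ?_⟩
        have h6 : (((((q ^ 2 - lam r ^ 2) * (q ^ 2 - lam t ^ 2) : ℕ) : ℚ)) : ℝ)
            = ((c * q ^ 2 * (c * q ^ 2) : ℚ) : ℝ) := by
          push_cast [Nat.cast_sub (hle r), Nat.cast_sub (hle t)]
          have : (c : ℝ) * q ^ 2 * (c * q ^ 2) = c ^ 2 * q ^ 4 := by ring
          rw [this, h5]
          field_simp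
        exact_mod_cast h6)
      s (Finset.univ.erase s) (fun r => 2 * ℓ r) (2 * ℓ s) (Finset.notMem_erase _ _) (by omega)
      (by
        rw [Finset.prod_erase_mul _ (f := fun r => z r ^ (2 * ℓ r)) (h := Finset.mem_univ s)]
        apply Subtype.ext
        have : ((∏ r, z r ^ (2 * ℓ r) : algebraicClosure ℚ ℂ) : ℂ)
            = ∏ r, Complex.exp (θ r * Complex.I) ^ (2 * ℓ r) := by
          simp only [← hzcoe]
          push_cast
          rfl
        rw [this]
        simp only [← Complex.exp_int_mul]
        rw [← Complex.exp_sum, OneMemClass.coe_one, Complex.exp_eq_one_iff]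
        refine ⟨-ℓ₀, ?_⟩
        have h1 := congrArg (fun x : ℝ => (x : ℂ)) h
        push_cast at h1 ⊢
        have h2 : ∑ r, (2 * (ℓ r : ℂ)) * ((θ r : ℂ) * Complex.I)
            = (∑ r, (ℓ r : ℂ) * (θ r : ℂ)) * (2 * Complex.I) := by
          rw [Finset.sum_mul]
          exact Finset.sum_congr rfl fun r _ => by ring
        rw [h2]
        linear_combination (2 * Complex.I) * h1)
    have h1 : Complex.exp (θ s * Complex.I) ^ N = 1 := by
      rw [← hzcoe]
      have h0 := congrArg (algebraMap (algebraicClosure ℚ ℂ) ℂ) hzN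
      rw [map_zpow₀, map_one] at h0
      exact h0
    rw [← Complex.exp_int_mul, Complex.exp_eq_one_iff] at h1
    obtain ⟨M, hM⟩ := h1
    have h2 : (N : ℝ) * θ s = M * (2 * Real.pi) := by
      have : (((N : ℝ) * θ s : ℝ) : ℂ) = ((M * (2 * Real.pi) : ℝ) : ℂ) := by
        push_cast
        apply mul_right_cancel₀ Complex.I_ne_zero
        linear_combination hM
      exact_mod_cast this
    have hNR : (N : ℝ) ≠ 0 := by exact_mod_cast hN
    have h3 := niven (θ := θ s) ⟨2 * M / N, by
      push_cast
      field_simp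
      linear_combination h2⟩ ⟨(lam s : ℚ) / q, by rw [hcos]; push_cast; rfl⟩
    rw [hcos] at h3
    have hl : (0 : ℝ) < lam s := by exact_mod_cast hpos s
    obtain ⟨h4, h5⟩ := hrange s
    simp only [Set.mem_insert_iff, Set.mem_singleton_iff, div_eq_iff hq'.ne'] at h3
    rcases h3 with h3 | h3 | h3 | h3 | h3 <;> rcases h4 with h4 | h4 <;> linarith
  refine ⟨?_, key⟩
  simp only [key, Int.cast_zero, zero_mul, Finset.sum_const_zero, add_zero] at h
  have := (mul_eq_zero.mp h).resolve_right Real.pi_ne_zero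
  exact_mod_cast this
end

section
/- Let p be an odd prime. For any two distinct integers j, k ∈ {1, 2, …, (p−1)/2}, the square-free parts of j(p−j) and k(p−k) are distinct; equivalently, j(p−j)·k(p−k) is not a perfect square. -/
/-- If `A * B` is a square then `A = g u²`, `B = g v²`. -/
lemma common_part (A B m : ℕ) (hA : 0 < A) (h : A * B = m * m) :
    ∃ g u v : ℕ, A = g * u ^ 2 ∧ B = g * v ^ 2 := by
  obtain ⟨a, b, hab, ha, hb⟩ := Nat.exists_coprime A B
  set g := A.gcd B with hg
  have hg0 : 0 < g := Nat.gcd_pos_of_pos_left _ hA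
  have h1 : g ^ 2 * (a * b) = m ^ 2 := by
    calc g ^ 2 * (a * b) = (a * g) * (b * g) := by ring
      _ = A * B := by rw [← ha, ← hb]
      _ = m ^ 2 := by rw [h]; ring
  have hd : g ∣ m := by
    rw [← Nat.pow_dvd_pow_iff (two_ne_zero)]
    exact ⟨_, h1.symm⟩
  obtain ⟨n, rfl⟩ := hd
  have h2 : a * b = n ^ 2 := by
    have : g ^ 2 * (a * b) = g ^ 2 * n ^ 2 := by rw [h1]; ring
    exact Nat.eq_of_mul_eq_mul_left (by positivity) this
  have hu : IsUnit (gcd a b) := by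
    rw [Nat.isUnit_iff]; exact hab
  have hu' : IsUnit (gcd b a) := by
    rw [Nat.isUnit_iff]; exact hab.symm
  obtain ⟨u, hu1⟩ := exists_associated_pow_of_mul_eq_pow hu h2
  obtain ⟨v, hv1⟩ := exists_associated_pow_of_mul_eq_pow hu' (by rw [mul_comm]; exact h2)
  rw [associated_iff_eq] at hu1 hv1
  exact ⟨g, u, v, by rw [hu1, mul_comm]; exact ha, by rw [hv1, mul_comm]; exact hb⟩

/-- for an odd prime `p` and distinct `j, k ∈ {1, …, (p-1)/2}`, the
square-free parts of `j(p-j)` and `k(p-k)` are distinct; equivalently,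
`j(p-j) · k(p-k)` is not a perfect square. -/
theorem stmt12 (p : ℕ) (hp : p.Prime) (hodd : Odd p) (j k : ℕ)
    (hj1 : 1 ≤ j) (hj2 : j ≤ (p - 1) / 2) (hk1 : 1 ≤ k) (hk2 : k ≤ (p - 1) / 2)
    (hjk : j ≠ k) :
    ¬ IsSquare (j * (p - j) * (k * (p - k))) := by
  rintro ⟨m, hm⟩
  have hp2 := hp.two_le
  obtain ⟨q, hq⟩ : ∃ q, q = p - j := ⟨_, rfl⟩
  obtain ⟨r, hr⟩ : ∃ r, r = p - k := ⟨_, rfl⟩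
  rw [← hq, ← hr] at hm
  have hjq : j + q = p := by omega
  have hkr : k + r = p := by omega
  have hkq : k < q := by omega
  have hjr : j < r := by omega
  have hjp : j < p := by omega
  have hrp : r < p := by omega
  obtain ⟨g, u, v, hA, hB⟩ := common_part (j * r) (k * q) m
    (Nat.mul_pos (by omega) (by omega)) (by rw [← hm]; ring)
  have hg : ¬ p ∣ g := by
    intro hd
    have : p ∣ j * r := hA ▸ hd.mul_right _
    rcases hp.dvd_mul.1 this with h | h
    · exact absurd (Nat.le_of_dvd (by omega) h) (by omega)
    · exact absurd (Nat.le_of_dvd (by omega) h) (by omega)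
  have hg0 : 0 < g := Nat.pos_of_ne_zero (fun h => hg (h ▸ dvd_zero p))
  have hmuv : m = g * u * v := by
    have : m ^ 2 = (g * u * v) ^ 2 := by
      calc m ^ 2 = (j * r) * (k * q) := by rw [sq, ← hm]; ring
        _ = _ := by rw [hA, hB]; ring
    exact Nat.pow_left_injective two_ne_zero this
  have hjqZ : (j : ℤ) + q = p := by exact_mod_cast hjq
  have hkrZ : (k : ℤ) + r = p := by exact_mod_cast hkr
  have hAZ : (j : ℤ) * r = g * u ^ 2 := by exact_mod_cast hA
  have hBZ : (k : ℤ) * q = g * v ^ 2 := by exact_mod_cast hB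
  have hmZ : (m : ℤ) = g * u * v := by exact_mod_cast hmuv
  have hmm : (j : ℤ) * q * (k * r) = m * m := by exact_mod_cast hm
  have key : (g : ℤ) * ((u - v) * (u + v)) = p * (j - k) := by
    linear_combination -hAZ + hBZ + (j:ℤ) * hkrZ - (k:ℤ) * hjqZ
  have huv : (u : ℤ) - v ≠ 0 := by
    intro h
    rw [h] at key
    have h0 : (p : ℤ) * (j - k) = 0 := by rw [← key]; ring
    rcases mul_eq_zero.1 h0 with h | h <;> omega
  have hpi : Prime (p : ℤ) := Nat.prime_iff_prime_int.1 hp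
  have hle : (p : ℤ) ≤ u + v := by
    rcases hpi.dvd_or_dvd (Dvd.intro _ key.symm) with h | h
    · exact absurd (by exact_mod_cast h) hg
    rcases hpi.dvd_or_dvd h with h | h
    · have := Int.le_of_dvd (abs_pos.2 huv) ((dvd_abs _ _).2 h)
      have h3 : |(u : ℤ) - v| ≤ u + v := by rw [abs_le]; constructor <;> omega
      omega
    · exact Int.le_of_dvd (by omega) h
  have hCD : (j : ℤ) * k < q * r := by
    have : j * k < q * r := by
      calc j * k = k * j := by ring
        _ < q * r := Nat.mul_lt_mul'' hkq hjr
    exact_mod_cast this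
  have h2m : 2 * (m : ℤ) < j * k + q * r := by
    apply lt_of_pow_lt_pow_left₀ 2 (by positivity)
    have : 0 < ((q : ℤ) * r - j * k) ^ 2 := by
      have : 0 < (q : ℤ) * r - j * k := by linarith
      positivity
    nlinarith
  have hsum : (g : ℤ) * (u + v) ^ 2 < p ^ 2 := by
    have e : (p : ℤ) ^ 2 = (j + q) * (k + r) := by rw [hjqZ, hkrZ]; ring
    rw [e]
    nlinarith
  have hg1 : (1 : ℤ) ≤ g := by exact_mod_cast hg0
  have : (p : ℤ) ^ 2 ≤ (u + v) ^ 2 := pow_le_pow_left₀ (by positivity) hle 2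
  nlinarith [sq_nonneg ((u : ℤ) + v)]
end

section
/- Let p be an odd prime. Then the real numbers π together with arccos((p − 2r)/p) for r = 1, 2, …, (p−1)/2 are linearly independent over ℚ: if ℓ_0, ℓ_1, …, ℓ_{(p−1)/2} are integers with ℓ_0·π + Σ_{r=1}^{(p−1)/2} ℓ_r·arccos((p−2r)/p) = 0, then all ℓ_r = 0. -/
/-- arithmetic core: `r(p-r)s(p-s)` is a square only if `r = s`. -/
theorem arith_core (p r s m : ℤ) (hp : Prime p) (hodd : Odd p) (hr : 0 < r) (hr2 : 2 * r < p)
    (hs : 0 < s) (hs2 : 2 * s < p) (hm : r * (p - r) * (s * (p - s)) = m ^ 2) : r = s := by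
  have key : ∀ n : ℤ, r * (p - r) * (s * (p - s)) = n ^ 2 →
      p ^ 2 ∣ ((p - 2 * r) * (p - 2 * s) + 4 * n) → r = s := by
    intro n hn ⟨k, hk⟩
    have hp0 : 0 < p := by linarith
    have hk0 : k ≠ 0 := by
      rintro rfl
      obtain ⟨t, rfl⟩ := hodd
      have h3 : 2 * (t - s) + 2 * (t - r) + 4 * (t - r) * (t - s) + 4 * n + 1 = 0 := by
        linear_combination hk
      have : (2 : ℤ) ∣ 1 := ⟨-((t - s) + (t - r) + 2 * (t - r) * (t - s) + 2 * n), by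
        linear_combination h3⟩
      omega
    have hprod : ((p - 2 * r) * (p - 2 * s) + 4 * n) * ((p - 2 * r) * (p - 2 * s) - 4 * n)
        = p ^ 2 * ((p - 2 * r) ^ 2 + (p - 2 * s) ^ 2 - p ^ 2) := by
      linear_combination 16 * hn
    have hp2 : (0 : ℤ) < p ^ 2 := by positivity
    have hle : ((p - 2 * r) * (p - 2 * s) + 4 * n) ^ 2 ≤ (p ^ 2) ^ 2 := by
      have h1 := sq_nonneg ((p - 2 * r) * (p - 2 * s) - 4 * n)
      have h2 : 2 * ((p - 2 * r) * (p - 2 * s)) * (4 * n)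
          ≤ (p - 2 * r) ^ 2 * (4 * (s * (p - s))) + 4 * (r * (p - r)) * (p - 2 * s) ^ 2 := by
        set X := (p - 2 * r) ^ 2 * (4 * (s * (p - s)))
        set Y := 4 * (r * (p - r)) * (p - 2 * s) ^ 2
        have hX : 0 ≤ X := by
          have : 0 ≤ p - s := by linarith
          positivity
        have hY : 0 ≤ Y := by
          have : 0 ≤ p - r := by linarith
          positivity
        have hXY : (2 * ((p - 2 * r) * (p - 2 * s)) * (4 * n)) ^ 2 = 4 * (X * Y) := by
          simp only [X, Y]
          linear_combination (-64 * (p - 2 * r) ^ 2 * (p - 2 * s) ^ 2) * hn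
        apply le_of_sq_le_sq _ (by positivity)
        rw [hXY]
        nlinarith [sq_nonneg (X - Y)]
      have e : (p ^ 2) ^ 2 - ((p - 2 * r) * (p - 2 * s) + 4 * n) ^ 2 =
        ((p - 2 * r) ^ 2 * (4 * (s * (p - s))) + 4 * (r * (p - r)) * (p - 2 * s) ^ 2)
        - 2 * ((p - 2 * r) * (p - 2 * s)) * (4 * n) := by
        linear_combination 16 * hn
      linarith
    have hk1 : k ^ 2 = 1 := by
      have h1 : k ^ 2 ≤ 1 := by
        rw [hk, mul_pow] at hle
        have : (0 : ℤ) < (p ^ 2) ^ 2 := by positivity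
        nlinarith
      have : 0 < k ^ 2 := by positivity
      omega
    have hA : 0 < p - 2 * r := by linarith
    have hC : 0 < p - 2 * s := by linarith
    have hother : k * ((p - 2 * r) * (p - 2 * s) - 4 * n)
        = (p - 2 * r) ^ 2 + (p - 2 * s) ^ 2 - p ^ 2 := by
      apply mul_left_cancel₀ hp2.ne'
      rw [← hprod, hk]; ring
    have hsum : 2 * k * ((p - 2 * r) * (p - 2 * s)) = (p - 2 * r) ^ 2 + (p - 2 * s) ^ 2 := by
      linear_combination hother + k * hk + p ^ 2 * hk1
    have hkk : k = 1 ∨ k = -1 := by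
      have : (k - 1) * (k + 1) = 0 := by linear_combination hk1
      rcases mul_eq_zero.mp this with h | h
      · left; linarith
      · right; linarith
    rcases hkk with rfl | rfl
    · have : (r - s) ^ 2 = 0 := by nlinarith
      have := pow_eq_zero_iff (two_ne_zero) |>.mp this
      linarith
    · nlinarith [mul_pos hA hC]
  have hprod : ((p - 2 * r) * (p - 2 * s) + 4 * m) * ((p - 2 * r) * (p - 2 * s) + 4 * (-m))
        = p ^ 2 * ((p - 2 * r) ^ 2 + (p - 2 * s) ^ 2 - p ^ 2) := by
      linear_combination 16 * hm
  have hnot : ∀ t : ℤ, 0 < t → t < p → ¬ p ∣ t := fun t h0 h1 h2 =>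
    absurd (Int.le_of_dvd h0 h2) (by linarith)
  have hp2 : ¬ p ∣ 2 := hnot 2 (by norm_num) (by
    rcases hodd with ⟨t, rfl⟩; omega)
  by_cases h1 : p ∣ ((p - 2 * r) * (p - 2 * s) + 4 * m)
  · have h2 : ¬ p ∣ ((p - 2 * r) * (p - 2 * s) + 4 * (-m)) := by
      intro h2
      have h3 := dvd_add h1 h2
      have h4 : p ∣ 2 * ((p - 2 * r) * (p - 2 * s)) := by
        have e : 2 * ((p - 2 * r) * (p - 2 * s)) = ((p - 2 * r) * (p - 2 * s) + 4 * m)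
            + ((p - 2 * r) * (p - 2 * s) + 4 * (-m)) := by ring
        rw [e]; exact h3
      rcases hp.dvd_or_dvd h4 with h | h
      · exact hp2 h
      rcases hp.dvd_or_dvd h with h | h
      · exact hnot _ (by linarith) (by linarith) h
      · exact hnot _ (by linarith) (by linarith) h
    exact key m hm (hp.pow_dvd_of_dvd_mul_right 2 h2 ⟨_, hprod⟩)
  · exact key (-m) (by rw [hm, neg_sq]) (hp.pow_dvd_of_dvd_mul_left 2 h1 ⟨_, hprod⟩)

theorem indep_abstract {K : Type*} [Field K] (S : Finset ℕ) (z : ℕ → K)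
    (hz : ∀ r ∈ S, z r ≠ 0)
    (hroot : ∀ r ∈ S, ∀ n : ℤ, z r ^ n = 1 → n = 0)
    (hsep : ∀ r ∈ S, ∀ s ∈ S, r ≠ s → ∃ (σ : K →+* K) (e : ℕ → ℤ),
      (∀ t ∈ S, σ (z t) = z t ^ e t) ∧ (∀ t ∈ S, e t = 1 ∨ e t = -1) ∧ e r ≠ e s) :
    ∀ (n : ℕ) (ℓ : ℕ → ℤ), (S.filter (fun r => ℓ r ≠ 0)).card = n →
      ∏ r ∈ S, z r ^ ℓ r = 1 → ∀ r ∈ S, ℓ r = 0 := by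
  intro n
  induction n using Nat.strong_induction_on with
  | _ n ih =>
  intro ℓ hn hprod r hr
  by_contra hne
  by_cases hex : ∃ s ∈ S, s ≠ r ∧ ℓ s ≠ 0
  · obtain ⟨s, hs, hsr, hls⟩ := hex
    obtain ⟨σ, e, hσ, he, hers⟩ := hsep r hr s hs (Ne.symm hsr)
    have h1 : ∏ t ∈ S, z t ^ (ℓ t * (1 + e t)) = 1 := by
      have h2 : ∏ t ∈ S, z t ^ (ℓ t * e t) = 1 := by
        have := congrArg σ hprod
        rw [map_prod, map_one] at this
        rw [← this]
        refine Finset.prod_congr rfl fun t ht => ?_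
        rw [map_zpow₀, hσ t ht, ← zpow_mul, mul_comm]
      calc _ = ∏ t ∈ S, (z t ^ ℓ t * z t ^ (ℓ t * e t)) := by
            refine Finset.prod_congr rfl fun t ht => ?_
            rw [← zpow_add₀ (hz t ht)]; congr 1; ring
        _ = 1 := by rw [Finset.prod_mul_distrib, hprod, h2, one_mul]
    have hlt : (S.filter (fun t => ℓ t * (1 + e t) ≠ 0)).card < n := by
      rw [← hn]
      apply Finset.card_lt_card
      rw [Finset.ssubset_iff_of_subset]
      · rcases he r hr with h | h
        · refine ⟨s, by simp [hs, hls], ?_⟩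
          rcases he s hs with h' | h'
          · omega
          · simp [h']
        · exact ⟨r, by simp [hr, hne], by simp [h]⟩
      · intro t
        simp only [Finset.mem_filter]
        rintro ⟨a, b⟩
        exact ⟨a, left_ne_zero_of_mul b⟩
    have hall := ih _ hlt _ rfl h1
    have a := hall r hr
    have b := hall s hs
    rcases he r hr with h | h
    · rw [h] at a; simp [hne] at a
    · rcases he s hs with h' | h'
      · rw [h'] at b; simp [hls] at b
      · omega
  · push Not at hex
    rw [Finset.prod_eq_single r (fun t ht htr => by rw [hex t ht htr, zpow_zero])
      (fun h => absurd hr h)] at hprod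
    exact hne (hroot r hr _ hprod)

theorem stmt13_aux (K : Type) [Field K] [Algebra ℚ K] [IsAlgClosed K]
    [Algebra.IsAlgebraic ℚ K] (p : ℕ) (hp : p.Prime) (hodd : Odd p) (ℓ₀ : ℤ) (ℓ : ℕ → ℤ)
    (h : (ℓ₀ : ℝ) * Real.pi
      + ∑ r ∈ Finset.Icc 1 ((p - 1) / 2),
          (ℓ r : ℝ) * Real.arccos (((p : ℝ) - 2 * r) / p) = 0) :
    ℓ₀ = 0 ∧ ∀ r ∈ Finset.Icc 1 ((p - 1) / 2), ℓ r = 0 := by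
  have hp0 : (0 : ℝ) < p := by exact_mod_cast hp.pos
  have hS : ∀ r ∈ Finset.Icc 1 ((p - 1) / 2), 0 < r ∧ 2 * r < p := by
    intro r hr
    rw [Finset.mem_Icc] at hr
    have := hp.pos
    omega
  suffices hmain : ∀ r ∈ Finset.Icc 1 ((p - 1) / 2), ℓ r = 0 by
    refine ⟨?_, hmain⟩
    rw [Finset.sum_eq_zero (fun r hr => by rw [hmain r hr]; simp), add_zero] at h
    exact_mod_cast (mul_eq_zero.mp h).resolve_right Real.pi_ne_zero
  let φ : K →ₐ[ℚ] ℂ := IsAlgClosed.lift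
  have hφ : Function.Injective φ := φ.toRingHom.injective
  have hw : ∀ r : ℕ, ∃ w : K, φ w = Complex.I * (Real.sqrt ((r : ℝ) * (p - r)) : ℂ) ∨
      ¬ (0 < r ∧ 2 * r < p) := by
    intro r
    by_cases hr : 0 < r ∧ 2 * r < p
    swap
    · exact ⟨0, Or.inr hr⟩
    obtain ⟨w, hw⟩ := IsAlgClosed.exists_pow_nat_eq (-((r : K) * (p - r))) (n := 2) two_pos
    have h1 : (φ w) ^ 2 = (Complex.I * (Real.sqrt ((r : ℝ) * (p - r)) : ℂ)) ^ 2 := by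
      rw [← map_pow, hw, mul_pow, Complex.I_sq, ← Complex.ofReal_pow, Real.sq_sqrt]
      · simp
      · have : (r : ℝ) ≤ p := by exact_mod_cast (by omega : r ≤ p)
        have : 0 ≤ (p : ℝ) - r := by linarith
        positivity
    rcases sq_eq_sq_iff_eq_or_eq_neg.mp h1 with h2 | h2
    · exact ⟨w, Or.inl h2⟩
    · exact ⟨-w, Or.inl (by rw [map_neg, h2, neg_neg])⟩
  choose w hw using hw
  replace hw : ∀ r : ℕ, 0 < r ∧ 2 * r < p →
      φ (w r) = Complex.I * (Real.sqrt ((r : ℝ) * (p - r)) : ℂ) :=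
    fun r hr => (hw r).resolve_right (not_not.mpr hr)
  have hnn : ∀ r : ℕ, 0 < r ∧ 2 * r < p → (0 : ℝ) ≤ (r : ℝ) * (p - r) := by
    intro r hr
    have : (r : ℝ) ≤ p := by exact_mod_cast (by omega : r ≤ p)
    have : 0 ≤ (p : ℝ) - r := by linarith
    positivity
  have hw2 : ∀ r : ℕ, 0 < r ∧ 2 * r < p → w r ^ 2 = -((r : K) * (p - r)) := by
    intro r hr
    apply hφ
    rw [map_pow, hw r hr, mul_pow, Complex.I_sq, ← Complex.ofReal_pow, Real.sq_sqrt (hnn r hr)]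
    simp
  have : IsAlgClosure ℚ K := ⟨inferInstance, inferInstance⟩
  have : Normal ℚ K := IsAlgClosure.normal ℚ K
  have : IsGalois ℚ K := ⟨⟩
  have : CharZero K := algebraRat.charZero K
  have hpK : (p : K) ≠ 0 := by exact_mod_cast hp.ne_zero
  let z : ℕ → K := fun r => ((p - 2 * r) + 2 * w r) / p
  have hzz : ∀ r : ℕ, 0 < r ∧ 2 * r < p → z r * (((p - 2 * r) - 2 * w r) / p) = 1 := by
    intro r hr
    simp only [z]
    field_simp
    linear_combination (-4) * hw2 r hr
  have hz0 : ∀ r : ℕ, 0 < r ∧ 2 * r < p → z r ≠ 0 := fun r hr => left_ne_zero_of_mul_eq_one (hzz r hr)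
  have hinv : ∀ r : ℕ, 0 < r ∧ 2 * r < p → (z r)⁻¹ = ((p - 2 * r) - 2 * w r) / p :=
    fun r hr => inv_eq_of_mul_eq_one_right (hzz r hr)
  have hexp : ∀ r : ℕ, 0 < r ∧ 2 * r < p →
      φ (z r) = Complex.exp (Complex.I * (Real.arccos (((p : ℝ) - 2 * r) / p) : ℝ)) := by
    intro r hr
    have hr2 : 2 * (r : ℝ) < p := by exact_mod_cast hr.2
    have hr0 : 0 < (r : ℝ) := by exact_mod_cast hr.1
    have hsin : Real.sin (Real.arccos (((p : ℝ) - 2 * r) / p))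
        = 2 * Real.sqrt ((r : ℝ) * (p - r)) / p := by
      rw [Real.sin_arccos, Real.sqrt_eq_iff_mul_self_eq_of_pos (by
        have : 0 < (p : ℝ) - r := by linarith
        positivity), ← sq]
      rw [div_pow, div_pow, mul_pow, Real.sq_sqrt (hnn r hr)]
      field_simp
      ring
    have hcos : Real.cos (Real.arccos (((p : ℝ) - 2 * r) / p)) = ((p : ℝ) - 2 * r) / p := by
      apply Real.cos_arccos
      · rw [le_div_iff₀ hp0]; linarith
      · rw [div_le_iff₀ hp0]; linarith
    rw [mul_comm, Complex.exp_mul_I, ← Complex.ofReal_cos, ← Complex.ofReal_sin, hsin, hcos]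
    simp only [z, map_div₀, map_add, map_sub, map_mul, map_natCast, map_ofNat, hw r hr]
    push_cast
    ring
  have hprod : ∏ r ∈ Finset.Icc 1 ((p - 1) / 2), z r ^ (2 * ℓ r) = 1 := by
    apply hφ
    rw [map_prod, map_one]
    have e1 : ∀ r ∈ Finset.Icc 1 ((p - 1) / 2), φ (z r ^ (2 * ℓ r)) =
        Complex.exp (2 * Complex.I * ((ℓ r : ℝ) * Real.arccos (((p : ℝ) - 2 * r) / p) : ℝ)) := by
      intro r hr
      rw [map_zpow₀, hexp r (hS r hr), ← Complex.exp_int_mul]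
      congr 1
      push_cast
      ring
    rw [Finset.prod_congr rfl e1, ← Complex.exp_sum, ← Finset.mul_sum, ← Complex.ofReal_sum,
      eq_neg_of_add_eq_zero_right h, Complex.exp_eq_one_iff]
    refine ⟨-ℓ₀, ?_⟩
    push_cast
    ring
  have hroot : ∀ r ∈ Finset.Icc 1 ((p - 1) / 2), ∀ n : ℤ, z r ^ n = 1 → n = 0 := by
    intro r hr n hn
    by_contra hn0
    have hnat : z r ^ n.natAbs = 1 := by
      rcases Int.natAbs_eq n with h' | h'
      · rw [h', zpow_natCast] at hn; exact hn
      · rw [h', zpow_neg, zpow_natCast, inv_eq_one] at hn; exact hn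
    have hpos : 0 < n.natAbs := Int.natAbs_pos.mpr hn0
    have i1 : IsIntegral ℤ (z r) := IsIntegral.of_pow hpos (hnat ▸ isIntegral_one)
    have i2 : IsIntegral ℤ (z r)⁻¹ := IsIntegral.of_pow hpos (by
      rw [inv_pow, hnat, inv_one]; exact isIntegral_one)
    have i3 := i1.add i2
    have e3 : z r + (z r)⁻¹ = algebraMap ℚ K ((2 * (p - 2 * r)) / p) := by
      rw [hinv r (hS r hr)]
      simp only [z, map_div₀, map_sub, map_mul, map_natCast, map_ofNat]
      field_simp
      ring
    rw [e3, isIntegral_algebraMap_iff (algebraMap ℚ K).injective] at i3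
    obtain ⟨k, hk⟩ := IsIntegrallyClosed.isIntegral_iff.mp i3
    have hpQ : (p : ℚ) ≠ 0 := by exact_mod_cast hp.ne_zero
    have hk2 : (k : ℚ) * p = 2 * (p - 2 * r) := by
      rw [eq_intCast] at hk
      rw [hk]; field_simp
    have hk3 : k * (p : ℤ) = 2 * (p - 2 * r) := by exact_mod_cast hk2
    have hd : (p : ℤ) ∣ ((2 * 2 * r : ℕ) : ℤ) := ⟨2 - k, by push_cast; linear_combination hk3⟩
    have hd2 : p ∣ 2 * 2 * r := by exact_mod_cast hd
    have hr' := hS r hr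
    have h2 : ¬ p ∣ 2 := fun h' => by
      have := Nat.le_of_dvd two_pos h'
      have := hp.two_le
      have : p = 2 := by omega
      subst this
      exact absurd hodd (by decide)
    rcases hp.dvd_mul.mp hd2 with h' | h'
    · rcases hp.dvd_mul.mp h' with h'' | h'' <;> exact h2 h''
    · have := Nat.le_of_dvd hr'.1 h'
      omega
  have hsep : ∀ r ∈ Finset.Icc 1 ((p - 1) / 2), ∀ s ∈ Finset.Icc 1 ((p - 1) / 2), r ≠ s →
      ∃ (σ : K →+* K) (e : ℕ → ℤ),
      (∀ t ∈ Finset.Icc 1 ((p - 1) / 2), σ (z t) = z t ^ e t) ∧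
      (∀ t ∈ Finset.Icc 1 ((p - 1) / 2), e t = 1 ∨ e t = -1) ∧ e r ≠ e s := by
    intro r hr s hs hrs
    have hr' := hS r hr
    have hs' := hS s hs
    have hex : ∃ σ : K ≃ₐ[ℚ] K, σ (w r * w s) ≠ w r * w s := by
      by_contra hcon
      push Not at hcon
      obtain ⟨q, hq⟩ := (InfiniteGalois.mem_range_algebraMap_iff_fixed (k := ℚ) (w r * w s)).mpr hcon
      have hq2 : q ^ 2 = (r * (p - r)) * (s * (p - s)) := by
        apply (algebraMap ℚ K).injective
        rw [map_pow, hq, mul_pow, hw2 r hr', hw2 s hs']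
        simp
      have hsq : IsSquare ((((r * (p - r)) * (s * (p - s)) : ℤ)) : ℚ) := by
        refine ⟨q, ?_⟩
        push_cast
        rw [← hq2, sq]
      rw [Rat.isSquare_intCast_iff] at hsq
      obtain ⟨m, hm⟩ := hsq
      apply hrs
      have := arith_core p r s m (Nat.prime_iff_prime_int.mp hp) (by exact_mod_cast hodd)
        (by exact_mod_cast hr'.1) (by exact_mod_cast hr'.2) (by exact_mod_cast hs'.1)
        (by exact_mod_cast hs'.2) (by rw [hm, sq])
      exact_mod_cast this
    obtain ⟨σ, hσ⟩ := hex
    classical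
    have hcase : ∀ t : ℕ, 0 < t ∧ 2 * t < p → σ (w t) = w t ∨ σ (w t) = - w t := by
      intro t ht
      apply sq_eq_sq_iff_eq_or_eq_neg.mp
      rw [← map_pow, hw2 t ht]
      simp
    refine ⟨(σ : K →+* K), fun t => if σ (w t) = w t then 1 else -1, ?_, ?_, ?_⟩
    · intro t ht
      have ht' := hS t ht
      have hσz : (σ : K →+* K) (z t) = ((p - 2 * t) + 2 * σ (w t)) / p := by
        have h2σ : σ 2 = 2 := map_ofNat σ 2
        simp [z, h2σ]
      rw [hσz]
      by_cases hc : σ (w t) = w t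
      · simp only [hc, if_true, zpow_one, z]
      · simp only [hc, if_false]
        rw [zpow_neg, zpow_one, hinv t ht', (hcase t ht').resolve_left hc]
        ring
    · intro t _
      by_cases hc : σ (w t) = w t <;> simp [hc]
    · intro heq
      apply hσ
      rw [map_mul]
      by_cases hc : σ (w r) = w r
      · by_cases hd : σ (w s) = w s
        · rw [hc, hd]
        · simp [hc, hd] at heq
      · by_cases hd : σ (w s) = w s
        · simp [hc, hd] at heq
        · rw [(hcase r hr').resolve_left hc, (hcase s hs').resolve_left hd, neg_mul_neg]
  intro r hr
  have := indep_abstract (Finset.Icc 1 ((p - 1) / 2)) z (fun r hr => hz0 r (hS r hr)) hroot hsep _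
    (fun r => 2 * ℓ r) rfl hprod r hr
  simpa using this

theorem stmt13 (p : ℕ) (hp : p.Prime) (hodd : Odd p) (ℓ₀ : ℤ) (ℓ : ℕ → ℤ)
    (h : (ℓ₀ : ℝ) * Real.pi
      + ∑ r ∈ Finset.Icc 1 ((p - 1) / 2),
          (ℓ r : ℝ) * Real.arccos (((p : ℝ) - 2 * r) / p) = 0) :
    ℓ₀ = 0 ∧ ∀ r ∈ Finset.Icc 1 ((p - 1) / 2), ℓ r = 0 := by
  have hA := AlgebraicClosure.isAlgebraic ℚ
  exact @stmt13_aux (AlgebraicClosure ℚ) _ _ inferInstance hA p hp hodd ℓ₀ ℓ h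
end
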